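/- Let W_k ~ Gamma(α_k, β) for k = 1,…,K be independent, U_j ~ Gamma(τ_j, β) independent of the W's, and Z a one-hot multinomial vector with probabilities ω, independent of everything. Define Y_k = W_k + Z_k U_k and π_k = Y_k / ∑_j Y_j. Then conditional on Z = e_j, the vector π is distributed as Dir(α + τ_j e_j), and hence π has the mixture law ∑_j ω_j Dir(α + τ_j e_j). -/

import Mathlib

open MeasureTheory ProbabilityTheory

/-- The Dirichlet measure with concentration `b`, defined by normalizing independent
Gamma random variables with common rate `1` (the rate does not matter). -/
noncomputable def dirichletMeasure {K : ℕ} (b : Fin K → ℝ) : Measure (Fin K → ℝ) :=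
  Measure.map (fun w k => w k / ∑ i, w i)
    (Measure.pi fun k => gammaMeasure (b k) 1)


lemma gamma_conv {a b r : ℝ} (ha : 0 < a) (hb : 0 < b) (hr : 0 < r) :
    (gammaMeasure a r) ∗ (gammaMeasure b r) = gammaMeasure (a + b) r := by
  have hm : ∀ a : ℝ, Measurable (gammaPDF a r) := fun a =>
    (measurable_gammaPDFReal a r).ennreal_ofReal
  unfold gammaMeasure
  rw [conv_withDensity_eq_lconvolution (hm a) (hm b)]
  apply withDensity_congr_ae
  have h0 : ∀ᵐ x : ℝ, x ≠ 0 := by simp [ae_iff]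
  filter_upwards [h0] with x hx
  rw [lconvolution_def]
  rcases lt_or_gt_of_ne hx with hx | hx
  · rw [gammaPDF_of_neg hx]
    rw [← lintegral_zero (μ := (volume : Measure ℝ))]
    congr 1
    funext y
    by_cases hy : y < 0
    · rw [gammaPDF_of_neg hy, zero_mul]
    · rw [gammaPDF_of_neg (x := -y + x) (by linarith), mul_zero]
  · have key : ∀ᵐ y : ℝ, gammaPDF a r y * gammaPDF b r (-y + x)
        = gammaPDF (a + b) r x * (ENNReal.ofReal |x⁻¹| * betaPDF a b (x⁻¹ * y)) := by
      have h1 : ∀ᵐ y : ℝ, y ≠ x := by simp [ae_iff]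
      filter_upwards [h0, h1] with y hy0 hyx
      rcases lt_or_gt_of_ne hy0 with hy | hy
      · rw [gammaPDF_of_neg hy, zero_mul, betaPDF_eq_zero_of_nonpos, mul_zero, mul_zero]
        exact mul_nonpos_of_nonneg_of_nonpos (by positivity) hy.le
      rcases lt_or_gt_of_ne hyx with hyx | hyx
      · have hz : 0 < -y + x := by linarith
        rw [gammaPDF_of_nonneg hy.le, gammaPDF_of_nonneg hz.le, gammaPDF_of_nonneg hx.le,
          betaPDF_of_pos_lt_one (by positivity)
            (by rw [inv_mul_eq_div, div_lt_one hx]; exact hyx)]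
        have g1 := Real.Gamma_pos_of_pos ha
        have g2 := Real.Gamma_pos_of_pos hb
        have g3 := Real.Gamma_pos_of_pos (add_pos ha hb)
        rw [← ENNReal.ofReal_mul (by positivity), ← ENNReal.ofReal_mul (by positivity),
          ← ENNReal.ofReal_mul (by positivity)]
        congr 1
        have e1 : 1 - x⁻¹ * y = (-y + x) / x := by field_simp; ring
        have e2 : x⁻¹ * y = y / x := by field_simp
        have e3 : Real.exp (-(r * x)) = Real.exp (-(r * y)) * Real.exp (-(r * (-y + x))) := by
          rw [← Real.exp_add]; congr 1; ring
        have e4 : x ^ (a + b - 1) = x ^ (a - 1) * x ^ (b - 1) * x := by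
          rw [← Real.rpow_add hx]
          nth_rewrite 3 [← Real.rpow_one x]
          rw [← Real.rpow_add hx]; congr 1; ring
        rw [e1, e2, Real.div_rpow hy.le hx.le, Real.div_rpow hz.le hx.le, e3, e4,
          Real.rpow_add hr, abs_of_pos (inv_pos.2 hx), beta]
        have p1 := Real.rpow_pos_of_pos hx (a - 1)
        have p2 := Real.rpow_pos_of_pos hx (b - 1)
        generalize x ^ (a - 1) = A at *
        generalize x ^ (b - 1) = B at *
        field_simp
      · rw [gammaPDF_of_neg (x := -y + x) (by linarith), mul_zero,
          betaPDF_eq_zero_of_one_le, mul_zero, mul_zero]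
        rw [inv_mul_eq_div, one_le_div hx]; exact hyx.le
    have hbm : Measurable (betaPDF a b) := (measurable_betaPDFReal a b).ennreal_ofReal
    rw [lintegral_congr_ae key, lintegral_const_mul _ (by fun_prop),
      lintegral_const_mul _ (by fun_prop)]
    have hx' : x⁻¹ ≠ 0 := by positivity
    have : ENNReal.ofReal |x⁻¹| * ∫⁻ y, betaPDF a b (x⁻¹ * y) = 1 := by
      rw [← lintegral_map (f := betaPDF a b) (g := fun y => x⁻¹ * y) hbm (by fun_prop),
        ← smul_eq_mul, ← lintegral_smul_measure, Real.smul_map_volume_mul_left hx',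
        lintegral_betaPDF_eq_one ha hb]
    rw [this, mul_one]

lemma gamma_scale {a r : ℝ} (hr : 0 < r) :
    (gammaMeasure a r).map (r * ·) = gammaMeasure a 1 := by
  have hm : ∀ r : ℝ, Measurable (gammaPDF a r) := fun r =>
    (measurable_gammaPDFReal a r).ennreal_ofReal
  have hmul : Measurable (fun x : ℝ => r * x) := by fun_prop
  ext s hs
  unfold gammaMeasure
  rw [Measure.map_apply hmul hs, withDensity_apply _ (hmul hs), withDensity_apply _ hs]
  conv_rhs => rw [← Real.smul_map_volume_mul_left hr.ne']
  rw [Measure.restrict_smul, lintegral_smul_measure, setLIntegral_map hs (hm 1) hmul,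
    smul_eq_mul, ← lintegral_const_mul _ (by have := hm 1; fun_prop)]
  have h0 : ∀ᵐ x : ℝ, x ≠ 0 := by simp [ae_iff]
  apply lintegral_congr_ae
  filter_upwards [ae_restrict_of_ae h0] with x hx
  rcases lt_or_gt_of_ne hx with hx | hx
  · rw [gammaPDF_of_neg hx, gammaPDF_of_neg (mul_neg_of_pos_of_neg hr hx), mul_zero]
  · rw [gammaPDF_of_nonneg hx.le, gammaPDF_of_nonneg (by positivity),
      ← ENNReal.ofReal_mul (by positivity), abs_of_pos hr, Real.mul_rpow hr.le hx.le,
      Real.rpow_sub hr, Real.rpow_one, Real.one_rpow]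
    congr 1
    field_simp

lemma dirichlet_rate {K : ℕ} (b : Fin K → ℝ) (hb : ∀ k, 0 < b k) {r : ℝ} (hr : 0 < r) :
    Measure.map (fun w k => w k / ∑ i, w i) (Measure.pi fun k => gammaMeasure (b k) r)
      = dirichletMeasure b := by
  have : ∀ k, IsProbabilityMeasure (gammaMeasure (b k) r) := fun k =>
    isProbabilityMeasure_gammaMeasure (hb k) hr
  have hmul : Measurable (fun x : ℝ => r * x) := by fun_prop
  have : ∀ k, IsProbabilityMeasure ((gammaMeasure (b k) r).map (r * ·)) := fun k =>
    Measure.isProbabilityMeasure_map hmul.aemeasurable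
  unfold dirichletMeasure
  have : (fun k => gammaMeasure (b k) 1) = fun k => (gammaMeasure (b k) r).map (r * ·) := by
    funext k; rw [gamma_scale hr]
  rw [this, ← Measure.pi_map_pi (fun k => hmul.aemeasurable),
    Measure.map_map (by fun_prop) (by fun_prop)]
  congr 1
  funext w k
  simp only [Function.comp]
  rw [← Finset.mul_sum, mul_div_mul_left _ _ hr.ne']

lemma pi_add_one {K : ℕ} (α τ : Fin K → ℝ) (hα : ∀ k, 0 < α k) (hτ : ∀ k, 0 < τ k)
    {r : ℝ} (hr : 0 < r) (j : Fin K) :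
    Measure.map (fun (q : (Fin K → ℝ) × (Fin K → ℝ)) k => q.1 k + (if j = k then q.2 k else 0))
      ((Measure.pi fun k => gammaMeasure (α k) r).prod (Measure.pi fun k => gammaMeasure (τ k) r))
      = Measure.pi fun i => gammaMeasure (α i + if i = j then τ j else 0) r := by
  have : ∀ k, IsProbabilityMeasure (gammaMeasure (α k) r) := fun k =>
    isProbabilityMeasure_gammaMeasure (hα k) hr
  have : ∀ k, IsProbabilityMeasure (gammaMeasure (τ k) r) := fun k =>
    isProbabilityMeasure_gammaMeasure (hτ k) hr
  have hf : ∀ k, Measurable (fun x : ℝ × ℝ => x.1 + (if j = k then x.2 else 0)) := by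
    intro k; split_ifs <;> fun_prop
  have hg : Measurable (fun (q : (Fin K → ℝ) × (Fin K → ℝ)) k =>
      q.1 k + (if j = k then q.2 k else 0)) := by
    refine measurable_pi_lambda _ fun k => ?_
    split_ifs <;> fun_prop
  have : ∀ k, IsProbabilityMeasure (((gammaMeasure (α k) r).prod (gammaMeasure (τ k) r)).map
      (fun x : ℝ × ℝ => x.1 + (if j = k then x.2 else 0))) := fun k =>
    Measure.isProbabilityMeasure_map (hf k).aemeasurable
  have mp := measurePreserving_arrowProdEquivProdArrow ℝ ℝ (Fin K)
    (fun k => gammaMeasure (α k) r) (fun k => gammaMeasure (τ k) r)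
  rw [← mp.map_eq, Measure.map_map hg mp.measurable]
  have := Measure.pi_map_pi (μ := fun k => (gammaMeasure (α k) r).prod (gammaMeasure (τ k) r))
    (f := fun k (x : ℝ × ℝ) => x.1 + (if j = k then x.2 else 0)) (fun k => (hf k).aemeasurable)
  refine Eq.trans ?_ (this.trans ?_)
  · rfl
  · congr 1
    funext k
    by_cases h : j = k
    · subst h
      simp only [if_true]
      exact gamma_conv (hα j) (hτ j) hr
    · simp only [if_neg h, if_neg (Ne.symm h), add_zero]
      exact (measurePreserving_fst (μ := gammaMeasure (α k) r) (ν := gammaMeasure (τ k) r)).map_eq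

theorem extended_flexible_dirichlet_construction {K : ℕ}
    (α τ : Fin K → ℝ) (hα : ∀ k, 0 < α k) (hτ : ∀ k, 0 < τ k)
    (β : ℝ) (hβ : 0 < β)
    (ω : Fin K → ℝ) (hω : ∀ k, 0 < ω k) (hs : ∑ k, ω k = 1)
    -- the joint law of `(W, (U, Z))`: independent Gammas `W_k ~ Γ(α_k, β)`,
    -- `U_k ~ Γ(τ_k, β)`, and an independent index `Z` with `P(Z = k) = ω_k`
    (P : Measure ((Fin K → ℝ) × (Fin K → ℝ) × Fin K))
    (hP : P = (Measure.pi fun k => gammaMeasure (α k) β).prod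
      ((Measure.pi fun k => gammaMeasure (τ k) β).prod
        (∑ k, ENNReal.ofReal (ω k) • Measure.dirac k)))
    -- `Y_k = W_k + Z_k U_k` and `π_k = Y_k / ∑_j Y_j`
    (Y : ((Fin K → ℝ) × (Fin K → ℝ) × Fin K) → Fin K → ℝ)
    (hY : Y = fun p k => p.1 k + (if p.2.2 = k then p.2.1 k else 0))
    (piv : ((Fin K → ℝ) × (Fin K → ℝ) × Fin K) → Fin K → ℝ)
    (hpiv : piv = fun p k => Y p k / ∑ i, Y p i) :
    (∀ j : Fin K,
      Measure.map piv (P[|{p | p.2.2 = j}])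
        = dirichletMeasure (fun i => α i + if i = j then τ j else 0))
    ∧ Measure.map piv P
        = ∑ j, ENNReal.ofReal (ω j)
            • dirichletMeasure (fun i => α i + if i = j then τ j else 0) := by
  have : ∀ k, IsProbabilityMeasure (gammaMeasure (α k) β) := fun k =>
    isProbabilityMeasure_gammaMeasure (hα k) hβ
  have : ∀ k, IsProbabilityMeasure (gammaMeasure (τ k) β) := fun k =>
    isProbabilityMeasure_gammaMeasure (hτ k) hβ
  set A := Measure.pi fun k => gammaMeasure (α k) β with hA
  set B := Measure.pi fun k => gammaMeasure (τ k) β with hB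
  have hι : ∀ k : Fin K, Measurable
      (fun q : (Fin K → ℝ) × (Fin K → ℝ) => (q.1, q.2, k)) := fun k => by fun_prop
  have hmY : Measurable Y := by
    rw [hY]
    refine measurable_pi_lambda _ fun k => ?_
    refine Measurable.add (by fun_prop) (Measurable.ite ?_ (by fun_prop) (by fun_prop))
    exact (measurable_snd.comp measurable_snd) (measurableSet_singleton k)
  have hmp : Measurable piv := by
    rw [hpiv]
    fun_prop
  have hPs : P = ∑ k, ENNReal.ofReal (ω k) • (A.prod B).map (fun q => (q.1, q.2, k)) := by
    rw [hP, ← Measure.sum_fintype, Measure.prod_sum_right, Measure.prod_sum_right,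
      Measure.sum_fintype]
    refine Finset.sum_congr rfl fun k _ => ?_
    rw [Measure.prod_smul_right, Measure.prod_smul_right]
    congr 1
    rw [Measure.prod_dirac]
    have := Measure.map_prod_map A B (f := id) (g := fun x => (x, k)) measurable_id (by fun_prop)
    rw [Measure.map_id] at this
    rw [this]
    rfl
  have hpush : ∀ j, ((A.prod B).map (fun q => (q.1, q.2, j))).map piv
      = dirichletMeasure (fun i => α i + if i = j then τ j else 0) := by
    intro j
    have hpos : ∀ i, 0 < α i + if i = j then τ j else 0 := by
      intro i
      have := hα i
      have := hτ j
      split_ifs <;> linarith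
    have hg : Measurable (fun (q : (Fin K → ℝ) × (Fin K → ℝ)) k =>
        q.1 k + (if j = k then q.2 k else 0)) := by
      refine measurable_pi_lambda _ fun k => ?_
      split_ifs <;> fun_prop
    rw [← dirichlet_rate _ hpos hβ, ← pi_add_one α τ hα hτ hβ j, Measure.map_map hmp (hι j),
      Measure.map_map (by fun_prop) hg, hpiv, hY]
    rfl
  refine ⟨fun j => ?_, ?_⟩
  · rw [← hpush j]
    congr 1
    have hS : MeasurableSet {p : (Fin K → ℝ) × (Fin K → ℝ) × Fin K | p.2.2 = j} :=
      (measurable_snd.comp measurable_snd) (measurableSet_singleton j)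
    have hval : ∀ t, MeasurableSet t → P ({p | p.2.2 = j} ∩ t)
        = ENNReal.ofReal (ω j) * (A.prod B).map (fun q => (q.1, q.2, j)) t := by
      intro t ht
      rw [hPs, Measure.finsetSum_apply, Finset.sum_eq_single j]
      · rw [Measure.smul_apply, smul_eq_mul, Measure.map_apply (hι j) (hS.inter ht),
          Measure.map_apply (hι j) ht]
        congr 2
        ext q
        simp
      · intro k _ hk
        rw [Measure.smul_apply, smul_eq_mul, Measure.map_apply (hι k) (hS.inter ht)]
        convert mul_zero _
        convert measure_empty (μ := A.prod B)
        ext q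
        simp [hk]
      · simp
    have : IsProbabilityMeasure ((A.prod B).map (fun q => (q.1, q.2, j))) :=
      Measure.isProbabilityMeasure_map (hι j).aemeasurable
    ext t ht
    rw [cond_apply hS, hval t ht]
    have := hval Set.univ MeasurableSet.univ
    rw [Set.inter_univ, measure_univ, mul_one] at this
    rw [this, ← mul_assoc, ENNReal.inv_mul_cancel, one_mul]
    · simpa using hω j
    · exact ENNReal.ofReal_ne_top
  · rw [hPs, ← Measure.mapₗ_apply_of_measurable hmp, map_sum]
    refine Finset.sum_congr rfl fun k _ => ?_
    rw [Measure.mapₗ_apply_of_measurable hmp, Measure.map_smul, hpush]
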